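/- Let m ≥ 1 be an integer and define e_m : on m-tuples of reals by e_m(u) = ∫_{(0,∞)^{m+2}} ((1 + k1 + Σ_{i=1}^m hi·ui²)(1 + k2 + Σ_{i=1}^m hi) − (1 + Σ_{i=1}^m hi·ui)²)^(−(m+3)/2) dk1 dk2 dh1 … dhm. Then for all real numbers a1,…,a_{m−1}, b with 1 < a1 < a2 < … < a_{m−1} < b, one has e_m( b/(b−1), b/(b−a1), …, b/(b−a_{m−1}) ) = ( (b−1)² · Π_{i=1}^{m−1} (b−ai)² / b^{m−1} ) · e_m(a1, …, a_{m−1}, b). (For m = 1 the statement reads: for b > 1, e_1(b/(b−1)) = (b−1)²·e_1(b).) -/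

import Mathlib

open MeasureTheory

/-- The function `e_m` of the paper: for `u ∈ ℝ^m`,
`e_m(u) = ∫_{(0,∞)^{m+2}} ((1 + k1 + Σᵢ hᵢuᵢ²)(1 + k2 + Σᵢ hᵢ) − (1 + Σᵢ hᵢuᵢ)²)^(−(m+3)/2)
dk1 dk2 dh`. -/
noncomputable def eFun (m : ℕ) (u : Fin m → ℝ) : ℝ :=
  ∫ p in ((Set.Ioi (0:ℝ) ×ˢ Set.Ioi (0:ℝ)) ×ˢ
      ((Set.univ : Set (Fin m)).pi fun _ => Set.Ioi (0:ℝ))),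
    ((1 + p.1.1 + ∑ i, p.2 i * u i ^ 2) * (1 + p.1.2 + ∑ i, p.2 i)
        - (1 + ∑ i, p.2 i * u i) ^ 2) ^ (-((m : ℝ) + 3) / 2)

/-- Lebesgue measure on the positive half line. -/
noncomputable def nuPos : Measure ℝ := volume.restrict (Set.Ioi (0:ℝ))

instance nuPos_sigmaFinite : SigmaFinite nuPos := by unfold nuPos; infer_instance

/-- Lebesgue measure on the positive orthant. -/
noncomputable def nuPi (n : ℕ) : Measure (Fin n → ℝ) := Measure.pi fun _ => nuPos

instance nuPi_sigmaFinite (n : ℕ) : SigmaFinite (nuPi n) := by unfold nuPi; infer_instance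

lemma nuPos_scale (c : ℝ) (hc : 0 < c) (f : ℝ → ENNReal) :
    ∫⁻ x, f x ∂nuPos = ENNReal.ofReal c * ∫⁻ x, f (c * x) ∂nuPos := by
  have him : (fun x : ℝ => c * x) '' Set.Ioi 0 = Set.Ioi 0 := by
    ext x
    constructor
    · rintro ⟨y, hy, rfl⟩
      exact mul_pos hc hy
    · intro hx
      exact ⟨x / c, div_pos hx hc, by field_simp⟩
  have h := lintegral_image_eq_lintegral_abs_deriv_mul (s := Set.Ioi (0:ℝ))
    (f := fun x => c * x) (f' := fun _ => c) measurableSet_Ioi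
    (fun x _ => by simpa using ((hasDerivAt_id x).const_mul c).hasDerivWithinAt)
    (fun x _ y _ h => mul_left_cancel₀ hc.ne' h) f
  rw [him] at h
  unfold nuPos
  rw [h, ← lintegral_const_mul' _ _ ENNReal.ofReal_ne_top, abs_of_pos hc]

lemma nuPos_inv (f : ℝ → ENNReal) :
    ∫⁻ x, f x ∂nuPos = ∫⁻ x, ENNReal.ofReal ((x ^ 2)⁻¹) * f x⁻¹ ∂nuPos := by
  have him : (fun x : ℝ => x⁻¹) '' Set.Ioi 0 = Set.Ioi 0 := by
    ext x
    constructor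
    · rintro ⟨y, hy, rfl⟩
      exact Set.mem_Ioi.2 (inv_pos.2 (Set.mem_Ioi.1 hy))
    · intro hx
      exact ⟨x⁻¹, Set.mem_Ioi.2 (inv_pos.2 (Set.mem_Ioi.1 hx)), by simp⟩
  have h := lintegral_image_eq_lintegral_abs_deriv_mul (s := Set.Ioi (0:ℝ))
    (f := fun x => x⁻¹) (f' := fun x => -(x ^ 2)⁻¹) measurableSet_Ioi
    (fun x hx => (hasDerivAt_inv (ne_of_gt hx)).hasDerivWithinAt)
    (fun x _ y _ h => inv_injective h) f
  rw [him] at h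
  unfold nuPos
  rw [h]
  refine lintegral_congr fun x => ?_
  rw [abs_neg, abs_of_nonneg (by positivity)]

lemma nuPi_scale (n : ℕ) (e : Fin n → ℝ) (he : ∀ i, 0 < e i) (f : (Fin n → ℝ) → ENNReal) :
    ∫⁻ y, f y ∂nuPi n = ENNReal.ofReal (∏ i, e i) * ∫⁻ y, f (fun i => e i * y i) ∂nuPi n := by
  have hS : nuPi n = (volume : Measure (Fin n → ℝ)).restrict
      ((Set.univ : Set (Fin n)).pi fun _ => Set.Ioi (0:ℝ)) := by
    unfold nuPi nuPos
    rw [volume_pi, Measure.restrict_pi_pi]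
  have him : (fun (y : Fin n → ℝ) i => e i * y i) ''
      ((Set.univ : Set (Fin n)).pi fun _ => Set.Ioi (0:ℝ))
      = ((Set.univ : Set (Fin n)).pi fun _ => Set.Ioi (0:ℝ)) := by
    ext x
    constructor
    · rintro ⟨y, hy, rfl⟩ i hi
      exact mul_pos (he i) (hy i hi)
    · intro hx
      refine ⟨fun i => x i / e i, fun i hi => div_pos (hx i hi) (he i), ?_⟩
      funext i
      have := (he i).ne'
      field_simp
  let L : (Fin n → ℝ) →L[ℝ] (Fin n → ℝ) :=
    LinearMap.toContinuousLinearMap (Matrix.toLin' (Matrix.diagonal e))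
  have hL : (fun (y : Fin n → ℝ) i => e i * y i) = L := by
    funext y i
    simp [L, Matrix.mulVec_diagonal]
  have hdet : L.det = ∏ i, e i := by
    simp [L, ContinuousLinearMap.det]
  have h := lintegral_image_eq_lintegral_abs_det_fderiv_mul
    (volume : Measure (Fin n → ℝ))
    (s := (Set.univ : Set (Fin n)).pi fun _ => Set.Ioi (0:ℝ))
    (f := fun (y : Fin n → ℝ) i => e i * y i) (f' := fun _ => L)
    (MeasurableSet.univ_pi fun _ => measurableSet_Ioi)
    (fun x _ => by rw [hL]; exact L.hasFDerivWithinAt)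
    (fun x _ y _ h => by
      funext i
      exact mul_left_cancel₀ (he i).ne' (congrFun h i)) f
  rw [him] at h
  rw [hS, h, ← lintegral_const_mul' _ _ ENNReal.ofReal_ne_top, hdet,
    abs_of_pos (Finset.prod_pos fun i _ => he i)]

lemma rpow_mul_pos (c x r : ℝ) (hc : 0 < c) : (c * x) ^ r = c ^ r * x ^ r := by
  rcases le_or_gt 0 x with hx | hx
  · exact Real.mul_rpow hc.le hx
  · rw [Real.rpow_def_of_neg hx, Real.rpow_def_of_neg (mul_neg_of_pos_of_neg hc hx),
      Real.rpow_def_of_pos hc, Real.log_mul hc.ne' hx.ne, ← mul_assoc, ← Real.exp_add]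
    ring_nf

lemma base_nonneg (m : ℕ) (u h : Fin m → ℝ) (k1 k2 : ℝ) (h1 : 0 < k1) (h2 : 0 < k2)
    (hh : ∀ i, 0 < h i) :
    0 ≤ (1 + k1 + ∑ i, h i * u i ^ 2) * (1 + k2 + ∑ i, h i) - (1 + ∑ i, h i * u i) ^ 2 := by
  have cs : (∑ i, h i * u i) ^ 2 ≤ (∑ i, h i * u i ^ 2) * ∑ i, h i :=
    Finset.sum_sq_le_sum_mul_sum_of_sq_le_mul _
      (fun i _ => mul_nonneg (hh i).le (sq_nonneg _)) (fun i _ => (hh i).le)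
      (fun i _ => le_of_eq (by ring))
  have hA : 0 ≤ ∑ i, h i * u i ^ 2 :=
    Finset.sum_nonneg fun i _ => mul_nonneg (hh i).le (sq_nonneg _)
  have hB : 0 ≤ ∑ i, h i := Finset.sum_nonneg fun i _ => (hh i).le
  have hAB : 0 ≤ (∑ i, h i * u i ^ 2) - 2 * (∑ i, h i * u i) + ∑ i, h i := by
    have : (∑ i, h i * u i ^ 2) - 2 * (∑ i, h i * u i) + ∑ i, h i
        = ∑ i, h i * (u i - 1) ^ 2 := by
      rw [Finset.mul_sum, ← Finset.sum_sub_distrib, ← Finset.sum_add_distrib]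
      exact Finset.sum_congr rfl fun i _ => by ring
    rw [this]
    exact Finset.sum_nonneg fun i _ => mul_nonneg (hh i).le (sq_nonneg _)
  have p1 := mul_pos h1 h2
  have p2 := mul_nonneg h1.le hB
  have p3 := mul_nonneg h2.le hA
  nlinarith

lemma eFun_eq (n : ℕ) (u : Fin (n + 1) → ℝ) (j : Fin (n + 1)) :
    eFun (n + 1) u = ENNReal.toReal (∫⁻ k1, ∫⁻ k2, ∫⁻ t, ∫⁻ y,
      ENNReal.ofReal (((1 + k1 + (t * u j ^ 2 + ∑ i, y i * u (j.succAbove i) ^ 2))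
          * (1 + k2 + (t + ∑ i, y i))
        - (1 + (t * u j + ∑ i, y i * u (j.succAbove i))) ^ 2) ^ (-((n : ℝ) + 4) / 2))
        ∂nuPi n ∂nuPos ∂nuPos ∂nuPos) := by
  have hμ : (volume : Measure ((ℝ × ℝ) × (Fin (n + 1) → ℝ))).restrict
      ((Set.Ioi (0:ℝ) ×ˢ Set.Ioi (0:ℝ)) ×ˢ
      ((Set.univ : Set (Fin (n + 1))).pi fun _ => Set.Ioi (0:ℝ)))
      = (nuPos.prod nuPos).prod (Measure.pi fun _ => nuPos) := by
    unfold nuPos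
    rw [Measure.volume_eq_prod, Measure.volume_eq_prod, volume_pi, ← Measure.prod_restrict,
      ← Measure.prod_restrict, Measure.restrict_pi_pi]
  have hexp : (-(((n + 1 : ℕ) : ℝ) + 3) / 2) = -((n : ℝ) + 4) / 2 := by push_cast; ring
  unfold eFun
  rw [hexp, integral_eq_lintegral_of_nonneg_ae]
  · congr 1
    rw [hμ, lintegral_prod _ (by fun_prop), lintegral_prod _ (by fun_prop)]
    refine lintegral_congr fun k1 => lintegral_congr fun k2 => ?_
    have hp := measurePreserving_piFinSuccAbove (fun _ : Fin (n + 1) => nuPos) j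
    rw [← (hp.symm _).lintegral_comp_emb (MeasurableEquiv.measurableEmbedding _)]
    rw [lintegral_prod]
    · refine lintegral_congr fun t => ?_
      unfold nuPi
      refine lintegral_congr fun y => ?_
      have hz : (MeasurableEquiv.piFinSuccAbove (fun _ : Fin (n + 1) => ℝ) j).symm (t, y)
          = j.insertNth t y := rfl
      rw [hz]
      simp only [Fin.sum_univ_succAbove _ j, Fin.insertNth_apply_same,
        Fin.insertNth_apply_succAbove]
    · refine Measurable.aemeasurable ?_
      refine Measurable.comp (g := fun h : Fin (n + 1) → ℝ => ENNReal.ofReal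
        (((1 + k1 + ∑ i, h i * u i ^ 2) * (1 + k2 + ∑ i, h i)
          - (1 + ∑ i, h i * u i) ^ 2) ^ (-((n : ℝ) + 4) / 2))) ?_
        (MeasurableEquiv.measurable _)
      fun_prop
  · refine ae_restrict_of_forall_mem ?_ ?_
    · exact (measurableSet_Ioi.prod measurableSet_Ioi).prod
        (MeasurableSet.univ_pi fun _ => measurableSet_Ioi)
    · rintro ⟨⟨k1, k2⟩, h⟩ ⟨⟨h1, h2⟩, hh⟩
      exact Real.rpow_nonneg (base_nonneg _ u h k1 k2 h1 h2 fun i => hh i trivial) _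
  · refine Measurable.aestronglyMeasurable ?_
    fun_prop

/-- The Gram determinant with all weights free. -/
noncomputable def gramD {n : ℕ} (a : Fin n → ℝ) (b x0 x1 xb xi : ℝ) (y : Fin n → ℝ) : ℝ :=
  (xi + x1 + (xb * b ^ 2 + ∑ i, y i * a i ^ 2)) * (x0 + x1 + (xb + ∑ i, y i))
    - (x1 + (xb * b + ∑ i, y i * a i)) ^ 2

lemma gramD_hom {n : ℕ} (a : Fin n → ℝ) (b x0 x1 xb xi c : ℝ) (y : Fin n → ℝ) :
    gramD a b (c * x0) (c * x1) (c * xb) (c * xi) (fun i => c * y i)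
      = c ^ 2 * gramD a b x0 x1 xb xi y := by
  unfold gramD
  simp only [mul_assoc, ← Finset.mul_sum]
  ring

/-- The integrand. -/
noncomputable def gramF {n : ℕ} (a : Fin n → ℝ) (b x0 x1 xb xi : ℝ) (y : Fin n → ℝ) : ENNReal :=
  ENNReal.ofReal (gramD a b x0 x1 xb xi y ^ (-((n : ℝ) + 4) / 2))

lemma sq_rpow_aux (n : ℕ) (c : ℝ) (hc : 0 < c) :
    (c ^ 2) ^ (-((n : ℝ) + 4) / 2) = (c ^ (n + 4))⁻¹ := by
  rw [← Real.rpow_natCast c 2, ← Real.rpow_mul hc.le, ← Real.rpow_natCast c (n + 4),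
    ← Real.rpow_neg hc.le]
  congr 1
  push_cast
  ring

lemma gramF_hom {n : ℕ} (a : Fin n → ℝ) (b x0 x1 xb xi c : ℝ) (hc : 0 < c) (y : Fin n → ℝ) :
    gramF a b (c * x0) (c * x1) (c * xb) (c * xi) (fun i => c * y i)
      = ENNReal.ofReal ((c ^ (n + 4))⁻¹) * gramF a b x0 x1 xb xi y := by
  unfold gramF
  rw [gramD_hom, rpow_mul_pos _ _ _ (by positivity), sq_rpow_aux n c hc,
    ENNReal.ofReal_mul (by positivity)]

/-- The integrand integrated over the `y` variables. -/
noncomputable def gramJ {n : ℕ} (a : Fin n → ℝ) (b x0 x1 xb xi : ℝ) : ENNReal :=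
  ∫⁻ y, gramF a b x0 x1 xb xi y ∂nuPi n

lemma gramJ_meas {n : ℕ} (a : Fin n → ℝ) (b : ℝ) :
    Measurable fun p : ℝ × ℝ × ℝ × ℝ => gramJ a b p.1 p.2.1 p.2.2.1 p.2.2.2 := by
  unfold gramJ
  refine Measurable.lintegral_prod_right'
    (f := fun q : (ℝ × ℝ × ℝ × ℝ) × (Fin n → ℝ) =>
      gramF a b q.1.1 q.1.2.1 q.1.2.2.1 q.1.2.2.2 q.2) ?_
  unfold gramF gramD
  fun_prop

lemma gramJ_hom {n : ℕ} (a : Fin n → ℝ) (b x0 x1 xb xi c : ℝ) (hc : 0 < c) :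
    gramJ a b (c * x0) (c * x1) (c * xb) (c * xi)
      = ENNReal.ofReal ((c ^ 4)⁻¹) * gramJ a b x0 x1 xb xi := by
  unfold gramJ
  rw [nuPi_scale n (fun _ => c) (fun _ => hc)]
  simp_rw [gramF_hom a b x0 x1 xb xi c hc]
  rw [lintegral_const_mul' _ _ ENNReal.ofReal_ne_top, ← mul_assoc,
    ← ENNReal.ofReal_mul (Finset.prod_nonneg fun _ _ => hc.le)]
  congr 2
  simp only [Finset.prod_const, Finset.card_univ, Fintype.card_fin]
  field_simp
  ring

/-- change of gauge -/
lemma gauge_change {n : ℕ} (a : Fin n → ℝ) (b : ℝ) :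
    ∫⁻ x1, ∫⁻ xi, ∫⁻ xb, gramJ a b 1 x1 xb xi ∂nuPos ∂nuPos ∂nuPos
      = ∫⁻ x0, ∫⁻ xi, ∫⁻ xb, gramJ a b x0 1 xb xi ∂nuPos ∂nuPos ∂nuPos := by
  rw [nuPos_inv fun x0 => ∫⁻ xi, ∫⁻ xb, gramJ a b x0 1 xb xi ∂nuPos ∂nuPos]
  unfold nuPos
  refine setLIntegral_congr_fun measurableSet_Ioi fun x hx => ?_
  have hx : 0 < x := hx
  change ∫⁻ xi, ∫⁻ xb, gramJ a b 1 x xb xi ∂nuPos ∂nuPos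
    = ENNReal.ofReal ((x ^ 2)⁻¹) * ∫⁻ xi, ∫⁻ xb, gramJ a b x⁻¹ 1 xb xi ∂nuPos ∂nuPos
  have key : ∀ xi xb : ℝ, gramJ a b 1 x (x * xb) (x * xi)
      = ENNReal.ofReal ((x ^ 4)⁻¹) * gramJ a b x⁻¹ 1 xb xi := by
    intro xi xb
    have := gramJ_hom a b x⁻¹ 1 xb xi x hx
    rwa [mul_one, mul_inv_cancel₀ hx.ne'] at this
  rw [nuPos_scale x hx]
  simp_rw [fun xi => nuPos_scale x hx (fun xb => gramJ a b 1 x xb (x * xi)), key]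
  simp_rw [lintegral_const_mul' _ _ ENNReal.ofReal_ne_top]
  rw [← mul_assoc, ← mul_assoc, ← ENNReal.ofReal_mul (by positivity),
    ← ENNReal.ofReal_mul (by positivity)]
  congr 2
  field_simp

lemma base_transform {n : ℕ} (a : Fin n → ℝ) (b xb x1 xi : ℝ) (y : Fin n → ℝ)
    (hab : ∀ i, a i < b) (hb : 1 < b) :
    (1 + xb + ((b - 1) ^ 2 / b ^ 2 * x1 * (b / (b - 1)) ^ 2
          + ∑ i, (b - a i) ^ 2 / b ^ 2 * y i * (b / (b - a i)) ^ 2))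
        * (1 + (b ^ 2)⁻¹ * xi + ((b - 1) ^ 2 / b ^ 2 * x1 + ∑ i, (b - a i) ^ 2 / b ^ 2 * y i))
      - (1 + ((b - 1) ^ 2 / b ^ 2 * x1 * (b / (b - 1))
          + ∑ i, (b - a i) ^ 2 / b ^ 2 * y i * (b / (b - a i)))) ^ 2
      = (b⁻¹) ^ 2 * gramD a b 1 x1 xb xi y := by
  have hb0 : b ≠ 0 := by linarith
  have hb1 : b - 1 ≠ 0 := by linarith
  have s1 : ∑ i, (b - a i) ^ 2 / b ^ 2 * y i * (b / (b - a i)) ^ 2 = ∑ i, y i := by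
    refine Finset.sum_congr rfl fun i _ => ?_
    have : b - a i ≠ 0 := by linarith [hab i]
    field_simp
  have s2 : ∑ i, (b - a i) ^ 2 / b ^ 2 * y i
      = (∑ i, y i) - 2 / b * (∑ i, y i * a i) + (b ^ 2)⁻¹ * ∑ i, y i * a i ^ 2 := by
    rw [Finset.mul_sum, Finset.mul_sum, ← Finset.sum_sub_distrib, ← Finset.sum_add_distrib]
    refine Finset.sum_congr rfl fun i _ => ?_
    field_simp
    ring
  have s3 : ∑ i, (b - a i) ^ 2 / b ^ 2 * y i * (b / (b - a i))
      = (∑ i, y i) - b⁻¹ * (∑ i, y i * a i) := by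
    rw [Finset.mul_sum, ← Finset.sum_sub_distrib]
    refine Finset.sum_congr rfl fun i _ => ?_
    have : b - a i ≠ 0 := by linarith [hab i]
    field_simp
  rw [s1, s2, s3]
  unfold gramD
  generalize ∑ i, y i = B
  generalize ∑ i, y i * a i = E
  generalize ∑ i, y i * a i ^ 2 = A
  field_simp
  ring

lemma swap3 (g : ℝ → ℝ → ℝ → ENNReal)
    (hg : Measurable fun p : (ℝ × ℝ) × ℝ => g p.1.1 p.1.2 p.2) :
    ∫⁻ x, ∫⁻ y, ∫⁻ z, g x y z ∂nuPos ∂nuPos ∂nuPos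
      = ∫⁻ z, ∫⁻ y, ∫⁻ x, g x y z ∂nuPos ∂nuPos ∂nuPos := by
  have e1 : ∀ x, ∫⁻ y, ∫⁻ z, g x y z ∂nuPos ∂nuPos = ∫⁻ z, ∫⁻ y, g x y z ∂nuPos ∂nuPos := by
    intro x
    have hm : Measurable (Function.uncurry (g x)) :=
      hg.comp (g := fun p : (ℝ × ℝ) × ℝ => g p.1.1 p.1.2 p.2)
        (f := fun q : ℝ × ℝ => ((x, q.1), q.2)) (by fun_prop)
    exact lintegral_lintegral_swap hm.aemeasurable
  have e3 : ∀ z, ∫⁻ x, ∫⁻ y, g x y z ∂nuPos ∂nuPos = ∫⁻ y, ∫⁻ x, g x y z ∂nuPos ∂nuPos := by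
    intro z
    have hm : Measurable (Function.uncurry fun x y => g x y z) :=
      hg.comp (g := fun p : (ℝ × ℝ) × ℝ => g p.1.1 p.1.2 p.2)
        (f := fun q : ℝ × ℝ => ((q.1, q.2), z)) (by fun_prop)
    exact lintegral_lintegral_swap hm.aemeasurable
  have hm2 : Measurable (Function.uncurry fun x z => ∫⁻ y, g x y z ∂nuPos) := by
    have hm : Measurable fun r : (ℝ × ℝ) × ℝ => g r.1.1 r.2 r.1.2 :=
      hg.comp (g := fun p : (ℝ × ℝ) × ℝ => g p.1.1 p.1.2 p.2)
        (f := fun r : (ℝ × ℝ) × ℝ => ((r.1.1, r.2), r.1.2)) (by fun_prop)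
    exact hm.lintegral_prod_right'
  rw [lintegral_congr e1, lintegral_lintegral_swap hm2.aemeasurable, lintegral_congr e3]

lemma swap_order {n : ℕ} (a : Fin n → ℝ) (b : ℝ) :
    ∫⁻ xb, ∫⁻ xi, ∫⁻ x1, gramJ a b 1 x1 xb xi ∂nuPos ∂nuPos ∂nuPos
      = ∫⁻ x1, ∫⁻ xi, ∫⁻ xb, gramJ a b 1 x1 xb xi ∂nuPos ∂nuPos ∂nuPos := by
  have hm : Measurable fun p : (ℝ × ℝ) × ℝ => gramJ a b 1 p.2 p.1.1 p.1.2 :=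
    (gramJ_meas a b).comp
      (g := fun p : ℝ × ℝ × ℝ × ℝ => gramJ a b p.1 p.2.1 p.2.2.1 p.2.2.2)
      (f := fun p : (ℝ × ℝ) × ℝ => (1, p.2, p.1.1, p.1.2)) (by fun_prop)
  exact swap3 (fun xb xi x1 => gramJ a b 1 x1 xb xi) hm

/-- the transformation formula for `e_m` under the cyclic automorphism of the
positive moduli space.  Writing `m = n + 1 ≥ 1` and given `1 < a₁ < … < a_{m−1} < b`,
`e_m(b/(b−1), b/(b−a₁), …, b/(b−a_{m−1})) = ((b−1)²·Π(b−aᵢ)²/b^{m−1})·e_m(a₁,…,a_{m−1},b)`. -/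
theorem stmt9 (n : ℕ) (a : Fin n → ℝ) (b : ℝ)
    (ha : ∀ i, 1 < a i) (hmono : StrictMono a) (hab : ∀ i, a i < b) (hb : 1 < b) :
    eFun (n + 1) (Fin.cons (b / (b - 1)) (fun i => b / (b - a i)))
      = (b - 1) ^ 2 * (∏ i, (b - a i) ^ 2) / b ^ n * eFun (n + 1) (Fin.snoc a b) := by
  have hb0 : 0 < b := by linarith
  have hb1 : 0 < b - 1 := by linarith
  have hJ := gramJ_meas a b
  -- right-hand side
  have hR : eFun (n + 1) (Fin.snoc a b) = ENNReal.toReal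
      (∫⁻ x0, ∫⁻ xi, ∫⁻ xb, gramJ a b x0 1 xb xi ∂nuPos ∂nuPos ∂nuPos) := by
    rw [eFun_eq n _ (Fin.last n)]
    simp only [Fin.succAbove_last, Fin.snoc_last, Fin.snoc_castSucc]
    rw [lintegral_lintegral_swap]
    · congr 1
      refine lintegral_congr fun x0 => lintegral_congr fun xi => lintegral_congr fun xb => ?_
      unfold gramJ gramF gramD
      refine lintegral_congr fun y => ?_
      congr 2
      ring
    · refine Measurable.aemeasurable ?_
      refine Measurable.lintegral_prod_right' (f := fun q : (ℝ × ℝ) × ℝ => ∫⁻ y,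
        ENNReal.ofReal (((1 + q.1.1 + (q.2 * b ^ 2 + ∑ i, y i * a i ^ 2))
          * (1 + q.1.2 + (q.2 + ∑ i, y i))
          - (1 + (q.2 * b + ∑ i, y i * a i)) ^ 2) ^ (-((n : ℝ) + 4) / 2)) ∂nuPi n) ?_
      refine Measurable.lintegral_prod_right' (f := fun r : ((ℝ × ℝ) × ℝ) × (Fin n → ℝ) =>
        ENNReal.ofReal (((1 + r.1.1.1 + (r.1.2 * b ^ 2 + ∑ i, r.2 i * a i ^ 2))
          * (1 + r.1.1.2 + (r.1.2 + ∑ i, r.2 i))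
          - (1 + (r.1.2 * b + ∑ i, r.2 i * a i)) ^ 2) ^ (-((n : ℝ) + 4) / 2))) ?_
      fun_prop
  have hprod : 0 < ∏ i, (b - a i) ^ 2 / b ^ 2 := Finset.prod_pos fun i _ => by
    have : 0 < b - a i := by linarith [hab i]
    positivity
  -- left-hand side
  have hL : eFun (n + 1) (Fin.cons (b / (b - 1)) (fun i => b / (b - a i))) = ENNReal.toReal
      (ENNReal.ofReal ((b - 1) ^ 2 * (∏ i, (b - a i) ^ 2) / b ^ n) *
        ∫⁻ xb, ∫⁻ xi, ∫⁻ x1, gramJ a b 1 x1 xb xi ∂nuPos ∂nuPos ∂nuPos) := by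
    rw [eFun_eq n _ 0]
    simp only [Fin.zero_succAbove, Fin.cons_zero, Fin.cons_succ]
    congr 1
    rw [← lintegral_const_mul' _ _ ENNReal.ofReal_ne_top]
    refine lintegral_congr fun xb => ?_
    rw [nuPos_scale (b ^ 2)⁻¹ (by positivity),
      ← lintegral_const_mul' _ _ ENNReal.ofReal_ne_top,
      ← lintegral_const_mul' _ _ ENNReal.ofReal_ne_top]
    refine lintegral_congr fun xi => ?_
    rw [nuPos_scale ((b - 1) ^ 2 / b ^ 2) (by positivity),
      ← lintegral_const_mul' _ _ ENNReal.ofReal_ne_top,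
      ← lintegral_const_mul' _ _ ENNReal.ofReal_ne_top,
      ← lintegral_const_mul' _ _ ENNReal.ofReal_ne_top]
    refine lintegral_congr fun x1 => ?_
    rw [nuPi_scale n (fun i => (b - a i) ^ 2 / b ^ 2) (fun i => by
      have : 0 < b - a i := by linarith [hab i]
      positivity)]
    simp_rw [base_transform a b xb x1 xi _ hab hb]
    simp_rw [rpow_mul_pos _ _ _ (show 0 < (b⁻¹) ^ 2 by positivity),
      sq_rpow_aux n b⁻¹ (by positivity),
      ENNReal.ofReal_mul (show 0 ≤ ((b⁻¹) ^ (n + 4))⁻¹ by positivity)]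
    rw [lintegral_const_mul' _ _ ENNReal.ofReal_ne_top]
    change _ = _ * gramJ a b 1 x1 xb xi
    change _ * (_ * (_ * (_ * gramJ a b 1 x1 xb xi))) = _
    simp only [← mul_assoc]
    rw [← ENNReal.ofReal_mul (by positivity), ← ENNReal.ofReal_mul (by positivity),
      ← ENNReal.ofReal_mul (by positivity)]
    congr 2
    rw [Finset.prod_div_distrib]
    simp only [Finset.prod_const, Finset.card_univ, Fintype.card_fin, inv_pow, inv_inv]
    field_simp
    ring
  have hC : 0 ≤ (b - 1) ^ 2 * (∏ i, (b - a i) ^ 2) / b ^ n :=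
    div_nonneg (mul_nonneg (sq_nonneg _) (Finset.prod_nonneg fun i _ => sq_nonneg _))
      (by positivity)
  rw [hL, hR, swap_order, gauge_change, ENNReal.toReal_mul, ENNReal.toReal_ofReal hC]
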